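/- Let S⁰ be an inverse semigroup with semilattice of idempotents E⁰, L a left inverse semigroup and R a right inverse semigroup such that S⁰ is a quasi-ideal inverse transversal of both L and R, and let ∗ : R × L → S⁰ satisfy: (1) for all y, z ∈ L and a, b ∈ R with y⁰ = b⁰, ((a∗y)(b⁰b))∗z = a∗((yy⁰)(b∗z)); (2) a∗x = ax whenever a ∈ S⁰ or x ∈ S⁰; (3) e∗f ∈ E⁰ for all e ∈ E(R), f ∈ E(L). Then T = {(x,a) ∈ L × R : x⁰ = a⁰} with multiplication (x,a)(y,b) = ((xx⁰)(a∗y), (a∗y)(b⁰b)) is a regular semigroup and T⁰ = {(s,s) : s ∈ S⁰} is a multiplicative inverse transversal of T isomorphic to S⁰. Conversely, if S is a regular semigroup with a multiplicative inverse transversal S⁰, then with L = {x ∈ S : x⁰x ∈ E⁰}, R = {x ∈ S : xx⁰ ∈ E⁰} and a∗x = ax, conditions (1)–(3) hold and S is isomorphic to the resulting T. -/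

import Mathlib

/-!
Common framework: "relative" semigroup-theoretic notions.  All notions are taken
relative to a carrier set `U` inside an ambient type, together with an explicit
binary operation `mul` (only the values of `mul` on `U` are relevant).  For an
honest semigroup `S` one takes `U = Set.univ` and `mul = mulOf S`.

* `RStarOn mul U a b` : the relation `a ℛ* b` computed in `U` with an identity
  adjoined (the two clauses correspond to multipliers from `U` and to the
  adjoined identity).
* `LStarOn`, `GreenLOn`, `GreenROn` : dual / Green's relations.
* `AbundantOn`, `AdequateOn`, `LeftAdequateOn`, `RightAdequateOn`.
* `AdequateTransversalOn mul U S0` : `S0` is an adequate `*`-subsemigroup of `U`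
  which is an adequate transversal, with the data `bar x = x̄`, `e x = e_x`,
  `f x = f_x`, and `plus s = s⁺`, `star s = s⋆` for `s ∈ S0`.
* `InverseTransversalOn mul U S0` : `S0` is an inverse transversal of the
  regular semigroup `U`, with `o x = x⁰` the unique inverse of `x` in `S0`.
-/

namespace Paper

universe u

variable {α : Type*} {β : Type*} {γ : Type*}

def mulOf (α : Type*) [Mul α] : α → α → α := fun a b => a * b

/-- `x` is an idempotent for the operation `mul`. -/
def Idem (mul : α → α → α) (x : α) : Prop := mul x x = x

/-- The relation `ℛ*` on `U` (with an identity adjoined to `U`). -/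
def RStarOn (mul : α → α → α) (U : Set α) (a b : α) : Prop :=
  (∀ x ∈ U, ∀ y ∈ U, (mul x a = mul y a ↔ mul x b = mul y b)) ∧
  (∀ x ∈ U, (mul x a = a ↔ mul x b = b))

/-- The relation `ℒ*` on `U` (with an identity adjoined to `U`). -/
def LStarOn (mul : α → α → α) (U : Set α) (a b : α) : Prop :=
  (∀ x ∈ U, ∀ y ∈ U, (mul a x = mul a y ↔ mul b x = mul b y)) ∧
  (∀ x ∈ U, (mul a x = a ↔ mul b x = b))

/-- Green's relation `ℒ` on `U`: `U¹ a = U¹ b`. -/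
def GreenLOn (mul : α → α → α) (U : Set α) (a b : α) : Prop :=
  (a = b ∨ ∃ u ∈ U, mul u b = a) ∧ (b = a ∨ ∃ v ∈ U, mul v a = b)

/-- Green's relation `ℛ` on `U`: `a U¹ = b U¹`. -/
def GreenROn (mul : α → α → α) (U : Set α) (a b : α) : Prop :=
  (a = b ∨ ∃ u ∈ U, mul b u = a) ∧ (b = a ∨ ∃ v ∈ U, mul a v = b)

/-- `U` is closed under `mul`. -/
def ClosedOn (mul : α → α → α) (U : Set α) : Prop :=
  ∀ a ∈ U, ∀ b ∈ U, mul a b ∈ U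

/-- `U` with the operation `mul` is a semigroup. -/
def SemigroupOn (mul : α → α → α) (U : Set α) : Prop :=
  ClosedOn mul U ∧ ∀ a ∈ U, ∀ b ∈ U, ∀ c ∈ U, mul (mul a b) c = mul a (mul b c)

/-- Every `ℛ*`-class and every `ℒ*`-class of `U` contains an idempotent. -/
def AbundantOn (mul : α → α → α) (U : Set α) : Prop :=
  ∀ a ∈ U, (∃ e ∈ U, Idem mul e ∧ RStarOn mul U a e) ∧
           (∃ f ∈ U, Idem mul f ∧ LStarOn mul U a f)

/-- Abundant with commuting idempotents. -/
def AdequateOn (mul : α → α → α) (U : Set α) : Prop :=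
  AbundantOn mul U ∧
    ∀ u ∈ U, ∀ v ∈ U, Idem mul u → Idem mul v → mul u v = mul v u

/-- Abundant, and every `ℛ*`-class contains a unique idempotent. -/
def LeftAdequateOn (mul : α → α → α) (U : Set α) : Prop :=
  AbundantOn mul U ∧
    ∀ u ∈ U, ∀ v ∈ U, Idem mul u → Idem mul v → RStarOn mul U u v → u = v

/-- Abundant, and every `ℒ*`-class contains a unique idempotent. -/
def RightAdequateOn (mul : α → α → α) (U : Set α) : Prop :=
  AbundantOn mul U ∧
    ∀ u ∈ U, ∀ v ∈ U, Idem mul u → Idem mul v → LStarOn mul U u v → u = v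

/-- `S0` is a quasi-ideal of `U` : `S0 U S0 ⊆ S0`. -/
def QuasiIdealOn (mul : α → α → α) (U S0 : Set α) : Prop :=
  ∀ s ∈ S0, ∀ x ∈ U, ∀ t ∈ S0, mul (mul s x) t ∈ S0

/-- Every element of `U` has an inverse in `U`. -/
def RegularOn (mul : α → α → α) (U : Set α) : Prop :=
  ∀ x ∈ U, ∃ u ∈ U, mul (mul x u) x = x ∧ mul (mul u x) u = u

/-- Regular with commuting idempotents, i.e. an inverse semigroup. -/
def InverseSgpOn (mul : α → α → α) (U : Set α) : Prop :=
  RegularOn mul U ∧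
    ∀ u ∈ U, ∀ v ∈ U, Idem mul u → Idem mul v → mul u v = mul v u

/-- Regular, and every Green `ℛ`-class contains a unique idempotent. -/
def LeftInverseSgpOn (mul : α → α → α) (U : Set α) : Prop :=
  RegularOn mul U ∧
    ∀ u ∈ U, ∀ v ∈ U, Idem mul u → Idem mul v → GreenROn mul U u v → u = v

/-- Regular, and every Green `ℒ`-class contains a unique idempotent. -/
def RightInverseSgpOn (mul : α → α → α) (U : Set α) : Prop :=
  RegularOn mul U ∧
    ∀ u ∈ U, ∀ v ∈ U, Idem mul u → Idem mul v → GreenLOn mul U u v → u = v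

/-- An isomorphism from `(A, mulA)` onto `(B, mulB)`. -/
def IsoOn (mulA : α → α → α) (mulB : β → β → β) (A : Set α) (B : Set β) : Prop :=
  ∃ θ : α → β, Set.BijOn θ A B ∧ ∀ a ∈ A, ∀ b ∈ A, θ (mulA a b) = mulB (θ a) (θ b)

/-- `S0` is an adequate transversal of the abundant semigroup `U`.  `S0` is an
adequate `*`-subsemigroup of `U` (witnessed by `plus`/`star`, the canonical
idempotents `a⁺ ℛ* a`, `a⋆ ℒ* a` of elements of `S0`, the `ℛ*`/`ℒ*` relations
being those of the big semigroup `U`, which gives the `*`-subsemigroup property),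
and every `x ∈ U` factors uniquely as `x = e_x x̄ f_x` with `x̄ ∈ S0`,
`e_x, f_x` idempotents of `U`, `e_x ℒ x̄⁺` and `f_x ℛ x̄⋆`. -/
structure AdequateTransversalOn (mul : α → α → α) (U S0 : Set α) where
  sub : S0 ⊆ U
  mul_mem : ∀ a ∈ S0, ∀ b ∈ S0, mul a b ∈ S0
  bar : α → α
  e : α → α
  f : α → α
  plus : α → α
  star : α → α
  plus_mem : ∀ a ∈ S0, plus a ∈ S0
  plus_idem : ∀ a ∈ S0, Idem mul (plus a)
  plus_rstar : ∀ a ∈ S0, RStarOn mul U a (plus a)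
  star_mem : ∀ a ∈ S0, star a ∈ S0
  star_idem : ∀ a ∈ S0, Idem mul (star a)
  star_lstar : ∀ a ∈ S0, LStarOn mul U a (star a)
  idem_comm : ∀ u ∈ S0, ∀ v ∈ S0, Idem mul u → Idem mul v → mul u v = mul v u
  bar_mem : ∀ x ∈ U, bar x ∈ S0
  e_mem : ∀ x ∈ U, e x ∈ U
  f_mem : ∀ x ∈ U, f x ∈ U
  e_idem : ∀ x ∈ U, Idem mul (e x)
  f_idem : ∀ x ∈ U, Idem mul (f x)
  decomp : ∀ x ∈ U, x = mul (mul (e x) (bar x)) (f x)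
  e_greenL : ∀ x ∈ U, GreenLOn mul U (e x) (plus (bar x))
  f_greenR : ∀ x ∈ U, GreenROn mul U (f x) (star (bar x))
  unique : ∀ x ∈ U, ∀ s ∈ S0, ∀ e' ∈ U, ∀ f' ∈ U, Idem mul e' → Idem mul f' →
      x = mul (mul e' s) f' → GreenLOn mul U e' (plus s) → GreenROn mul U f' (star s) →
      s = bar x ∧ e' = e x ∧ f' = f x

namespace AdequateTransversalOn

variable {mul : α → α → α} {U S0 : Set α}

/-- `R = {x ∈ U : e_x = e_{x̄}}`. -/
def Rset (T : AdequateTransversalOn mul U S0) : Set α :=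
  {x | x ∈ U ∧ T.e x = T.e (T.bar x)}

/-- `L = {x ∈ U : f_x = f_{x̄}}`. -/
def Lset (T : AdequateTransversalOn mul U S0) : Set α :=
  {x | x ∈ U ∧ T.f x = T.f (T.bar x)}

/-- `I = {e_x : x ∈ U}`. -/
def Iset (T : AdequateTransversalOn mul U S0) : Set α :=
  {y | ∃ x ∈ U, T.e x = y}

/-- `Λ = {f_x : x ∈ U}`. -/
def LamSet (T : AdequateTransversalOn mul U S0) : Set α :=
  {y | ∃ x ∈ U, T.f x = y}

/-- The transversal is multiplicative: `Λ I ⊆ E⁰`. -/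
def IsMultiplicative (T : AdequateTransversalOn mul U S0) : Prop :=
  ∀ l ∈ T.LamSet, ∀ i ∈ T.Iset, mul l i ∈ S0 ∧ Idem mul (mul l i)

end AdequateTransversalOn

/-- The spined product set `T = L |×| R ⊆ S × S` attached to an adequate
transversal of `S` (ambient carrier `U`). -/
def spSet {mul : α → α → α} {U S0 : Set α}
    (T : AdequateTransversalOn mul U S0) : Set (α × α) :=
  {p | p.1 ∈ T.Lset ∧ p.2 ∈ T.Rset ∧ T.bar p.1 = T.bar p.2}

/-- The multiplication `(x,a)(y,b) = (e_x(ay), (ay) f_b)` on the spined product. -/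
def spMul {mul : α → α → α} {U S0 : Set α}
    (T : AdequateTransversalOn mul U S0) : α × α → α × α → α × α :=
  fun p q => (mul (T.e p.1) (mul p.2 q.1), mul (mul p.2 q.1) (T.f q.2))

/-- The map `φ : S → T`, `x ↦ (e_x x̄, x̄ f_x)`. -/
def phiMap {mul : α → α → α} {U S0 : Set α}
    (T : AdequateTransversalOn mul U S0) : α → α × α :=
  fun x => (mul (T.e x) (T.bar x), mul (T.bar x) (T.f x))

/-- `T⁰ = {(s,s) : s ∈ S0}`. -/
def diagSet (S0 : Set α) : Set (α × α) := {p | ∃ s ∈ S0, p = (s, s)}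

/-- Abstract spined product `L |×| R` over a common transversal `S⁰` (a type `γ`
embedded into `L` and `R` by `jL`, `jR`). -/
def absTset {mulL : α → α → α} {mulR : β → β → β} {jL : γ → α} {jR : γ → β}
    (TL : AdequateTransversalOn mulL Set.univ (Set.range jL))
    (TR : AdequateTransversalOn mulR Set.univ (Set.range jR)) : Set (α × β) :=
  {p | ∃ s : γ, jL s = TL.bar p.1 ∧ jR s = TR.bar p.2}

/-- The multiplication `(x,a)(y,b) = (e_x(a∗y), (a∗y) f_b)`. -/
def absMul {mulL : α → α → α} {mulR : β → β → β} {jL : γ → α} {jR : γ → β}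
    (TL : AdequateTransversalOn mulL Set.univ (Set.range jL))
    (TR : AdequateTransversalOn mulR Set.univ (Set.range jR))
    (st : β → α → γ) : α × β → α × β → α × β :=
  fun p q => (mulL (TL.e p.1) (jL (st p.2 q.1)), mulR (jR (st p.2 q.1)) (TR.f q.2))

/-- `T⁰ = {(s,s) : s ∈ S⁰}` inside `L × R`, where `s` is viewed in `L` and in `R`. -/
def absT0 (jL : γ → α) (jR : γ → β) : Set (α × β) :=
  {p | ∃ s : γ, p = (jL s, jR s)}

/-- `S0` is an inverse transversal of the regular semigroup `U`: an inverse
subsemigroup meeting the set of inverses of each `x ∈ U` in exactly one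
element `o x = x⁰`. -/
structure InverseTransversalOn (mul : α → α → α) (U S0 : Set α) where
  sub : S0 ⊆ U
  mul_mem : ∀ a ∈ S0, ∀ b ∈ S0, mul a b ∈ S0
  o : α → α
  o_mem : ∀ x ∈ U, o x ∈ S0
  o_inv1 : ∀ x ∈ U, mul (mul x (o x)) x = x
  o_inv2 : ∀ x ∈ U, mul (mul (o x) x) (o x) = o x
  o_unique : ∀ x ∈ U, ∀ u ∈ S0, mul (mul x u) x = x → mul (mul u x) u = u → u = o x
  idem_comm : ∀ u ∈ S0, ∀ v ∈ S0, Idem mul u → Idem mul v → mul u v = mul v u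

namespace InverseTransversalOn

variable {mul : α → α → α} {U S0 : Set α}

/-- `L = {x ∈ U : x⁰x ∈ E⁰}`. -/
def LsetI (T : InverseTransversalOn mul U S0) : Set α :=
  {x | x ∈ U ∧ mul (T.o x) x ∈ S0 ∧ Idem mul (mul (T.o x) x)}

/-- `R = {x ∈ U : xx⁰ ∈ E⁰}`. -/
def RsetI (T : InverseTransversalOn mul U S0) : Set α :=
  {x | x ∈ U ∧ mul x (T.o x) ∈ S0 ∧ Idem mul (mul x (T.o x))}

end InverseTransversalOn

/-- Spined product set for an inverse transversal: `{(x,a) : x⁰ = a⁰}`. -/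
def invSpSet {mul : α → α → α} {U S0 : Set α}
    (T : InverseTransversalOn mul U S0) : Set (α × α) :=
  {p | p.1 ∈ T.LsetI ∧ p.2 ∈ T.RsetI ∧ T.o p.1 = T.o p.2}

/-- The multiplication `(x,a)(y,b) = ((xx⁰)(ay), (ay)(b⁰b))`. -/
def invSpMul {mul : α → α → α} {U S0 : Set α}
    (T : InverseTransversalOn mul U S0) : α × α → α × α → α × α :=
  fun p q => (mul (mul p.1 (T.o p.1)) (mul p.2 q.1),
              mul (mul p.2 q.1) (mul (T.o q.2) q.2))

/-- Abstract spined product for inverse transversals: `{(x,a) : x⁰ = a⁰}`. -/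
def invAbsTset {mulL : α → α → α} {mulR : β → β → β} {jL : γ → α} {jR : γ → β}
    (TL : InverseTransversalOn mulL Set.univ (Set.range jL))
    (TR : InverseTransversalOn mulR Set.univ (Set.range jR)) : Set (α × β) :=
  {p | ∃ s : γ, jL s = TL.o p.1 ∧ jR s = TR.o p.2}

/-- The multiplication `(x,a)(y,b) = ((xx⁰)(a∗y), (a∗y)(b⁰b))`. -/
def invAbsMul {mulL : α → α → α} {mulR : β → β → β} {jL : γ → α} {jR : γ → β}
    (TL : InverseTransversalOn mulL Set.univ (Set.range jL))
    (TR : InverseTransversalOn mulR Set.univ (Set.range jR))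
    (st : β → α → γ) : α × β → α × β → α × β :=
  fun p q => (mulL (mulL p.1 (TL.o p.1)) (jL (st p.2 q.1)),
              mulR (jR (st p.2 q.1)) (mulR (TR.o q.2) q.2))

/-- The multiplication `(e,x)(g,w) = (e(aa⁻¹), a)`, `a = x((x⁻¹x)g)w`, on `I × S⁰`
(Chen-style construction from a left normal band `I` with semilattice transversal
`E⁰ = E(S⁰)`; `σ` embeds idempotents of the inverse semigroup `γ` into the band
`β`, and `π : β → γ` is the semilattice-transversal map `e ↦ e⁰`). -/
def bandMul (mulB : β → β → β) (mulG : γ → γ → γ) (σ : γ → β) (π : β → γ)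
    (inv : γ → γ) (p q : β × γ) : β × γ :=
  let a := mulG (mulG p.2 (π (mulB (σ (mulG (inv p.2) p.2)) q.1))) q.2
  (mulB p.1 (σ (mulG a (inv a))), a)

/-- `T = {(e,x) : e⁰ = xx⁻¹}`. -/
def bandTset (mulG : γ → γ → γ) (π : β → γ) (inv : γ → γ) : Set (β × γ) :=
  {p | π p.1 = mulG p.2 (inv p.2)}

/-- `T⁰ = {(aa⁻¹, a) : a ∈ S⁰}` (with `aa⁻¹` viewed in the band via `σ`). -/
def bandT0 (mulG : γ → γ → γ) (σ : γ → β) (inv : γ → γ) : Set (β × γ) :=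
  {p | ∃ s : γ, p = (σ (mulG s (inv s)), s)}

end Paper

namespace Paper

namespace InverseTransversalOn

section Semigroup

variable {S : Type*} [Semigroup S] {S0 : Set S}

theorem mul_comm_of_idem (T : InverseTransversalOn (mulOf S) Set.univ S0) {u v : S} (hu : u ∈ S0)
    (hv : v ∈ S0) (hu' : u * u = u) (hv' : v * v = v) : u * v = v * u :=
  T.idem_comm u hu v hv hu' hv'

theorem mul_mem_of_mem (T : InverseTransversalOn (mulOf S) Set.univ S0) {u v : S} (hu : u ∈ S0)
    (hv : v ∈ S0) : u * v ∈ S0 :=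
  T.mul_mem u hu v hv

variable (T : InverseTransversalOn (mulOf S) Set.univ S0)

theorem o_mem_transversal (x : S) : T.o x ∈ S0 := T.o_mem x trivial

theorem mul_o_mul (x : S) : x * T.o x * x = x := T.o_inv1 x trivial

theorem o_mul_o (x : S) : T.o x * x * T.o x = T.o x := T.o_inv2 x trivial

theorem o_eq {x u : S} (hu : u ∈ S0) (h₁ : x * u * x = x) (h₂ : u * x * u = u) : T.o x = u :=
  (T.o_unique x trivial u hu h₁ h₂).symm

theorem o_o_of_mem {s : S} (hs : s ∈ S0) : T.o (T.o s) = s :=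
  T.o_eq hs (T.o_mul_o s) (T.mul_o_mul s)

theorem o_mul_self {x : S} (hx : x ∈ T.LsetI) : T.o x * x = T.o x * T.o (T.o x) := by
  have h1 := T.mul_o_mul (T.o x)
  have h2 := T.o_mul_o x
  have h := T.mul_comm_of_idem hx.2.1
    (T.mul_mem_of_mem (T.o_mem_transversal x) (T.o_mem_transversal (T.o x))) hx.2.2 (by grind)
  calc T.o x * x = T.o x * T.o (T.o x) * (T.o x * x) := by rw [← mul_assoc, h1]
    _ = T.o x * x * (T.o x * T.o (T.o x)) := h.symm
    _ = T.o x * T.o (T.o x) := by rw [← mul_assoc, h2]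

theorem self_mul_o {x : S} (hx : x ∈ T.RsetI) : x * T.o x = T.o (T.o x) * T.o x := by
  have h1 := T.mul_o_mul (T.o x)
  have h2 := T.o_mul_o x
  have h := T.mul_comm_of_idem hx.2.1
    (T.mul_mem_of_mem (T.o_mem_transversal (T.o x)) (T.o_mem_transversal x)) hx.2.2 (by grind)
  calc x * T.o x = x * T.o x * (T.o (T.o x) * T.o x) := by rw [mul_assoc, ← mul_assoc (T.o x), h1]
    _ = T.o (T.o x) * T.o x * (x * T.o x) := h
    _ = T.o (T.o x) * T.o x := by rw [mul_assoc, ← mul_assoc (T.o x), h2]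

theorem o_mul_of_leftInverse (hS : LeftInverseSgpOn (mulOf S) Set.univ) (x : S) :
    T.o x * x = T.o x * T.o (T.o x) := by
  have h1 := T.o_mul_o x
  have h2 := T.mul_o_mul (T.o x)
  refine hS.2 _ trivial _ trivial ?_ ?_
    ⟨Or.inr ⟨T.o x * x, trivial, ?_⟩, Or.inr ⟨T.o x * T.o (T.o x), trivial, ?_⟩⟩ <;>
  · simp only [Idem, mulOf]
    grind

theorem mul_o_of_rightInverse (hS : RightInverseSgpOn (mulOf S) Set.univ) (x : S) :
    x * T.o x = T.o (T.o x) * T.o x := by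
  have h1 := T.o_mul_o x
  have h2 := T.mul_o_mul (T.o x)
  refine hS.2 _ trivial _ trivial ?_ ?_
    ⟨Or.inr ⟨x * T.o x, trivial, ?_⟩, Or.inr ⟨T.o (T.o x) * T.o x, trivial, ?_⟩⟩ <;>
  · simp only [Idem, mulOf]
    grind

theorem mem_LsetI {x : S} (h : T.o x * x = T.o x * T.o (T.o x)) : x ∈ T.LsetI := by
  have h2 := T.o_mul_o x
  refine ⟨trivial, ?_, ?_⟩
  · change T.o x * x ∈ S0
    rw [h]
    exact T.mul_mem_of_mem (T.o_mem_transversal x) (T.o_mem_transversal (T.o x))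
  · change T.o x * x * (T.o x * x) = T.o x * x
    grind

theorem mem_RsetI {x : S} (h : x * T.o x = T.o (T.o x) * T.o x) : x ∈ T.RsetI := by
  have h2 := T.o_mul_o x
  refine ⟨trivial, ?_, ?_⟩
  · change x * T.o x ∈ S0
    rw [h]
    exact T.mul_mem_of_mem (T.o_mem_transversal (T.o x)) (T.o_mem_transversal x)
  · change x * T.o x * (x * T.o x) = x * T.o x
    grind

theorem o_mul_o_o (x : S) : T.o (x * T.o x * T.o (T.o x)) = T.o x := by
  have h1 := T.mul_o_mul (T.o x)
  have h2 := T.o_mul_o x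
  exact T.o_eq (T.o_mem_transversal x) (by grind) (by grind)

theorem o_o_o_mul (x : S) : T.o (T.o (T.o x) * T.o x * x) = T.o x := by
  have h1 := T.mul_o_mul (T.o x)
  have h2 := T.o_mul_o x
  exact T.o_eq (T.o_mem_transversal x) (by grind) (by grind)

theorem left_mem_LsetI (x : S) : x * T.o x * T.o (T.o x) ∈ T.LsetI := by
  have h2 := T.o_mul_o x
  exact T.mem_LsetI (by rw [o_mul_o_o]; grind)

theorem right_mem_RsetI (x : S) : T.o (T.o x) * T.o x * x ∈ T.RsetI := by
  have h2 := T.o_mul_o x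
  exact T.mem_RsetI (by rw [o_o_o_mul]; grind)

theorem o_mul_o_mul {x a : S} (h : T.o x = T.o a) : T.o (x * T.o x * a) = T.o x := by
  have h2 := T.o_mul_o a
  have h3 := T.o_mul_o x
  exact T.o_eq (T.o_mem_transversal x) (by grind) (by grind)

/-- `S0` is a multiplicative inverse transversal. -/
def IsMultiplicative : Prop :=
  ∀ x y : S, T.o x * x * (y * T.o y) ∈ S0 ∧ Idem (mulOf S) (T.o x * x * (y * T.o y))

variable {T}

theorem IsMultiplicative.o_mul (hT : T.IsMultiplicative) (x y : S) :
    T.o (x * y) = T.o y * (T.o x * x * (y * T.o y)) * T.o x ∧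
      T.o (T.o (x * y)) = T.o (T.o x) * (T.o x * x * (y * T.o y)) * T.o (T.o y) := by
  obtain ⟨hm, hi⟩ := hT x y
  generalize hh : T.o x * x * (y * T.o y) = h at hm hi
  have hi : h * h = h := hi
  have hx1 := T.mul_o_mul x
  have hx3 := T.mul_o_mul (T.o x)
  have hy1 := T.mul_o_mul y
  have hy3 := T.mul_o_mul (T.o y)
  have hmem {u v : S} (hu : u ∈ S0) (hv : v ∈ S0) : u * h * v ∈ S0 :=
    T.mul_mem_of_mem (T.mul_mem_of_mem hu hm) hv
  have hxh : T.o x * T.o (T.o x) * h = h := by grind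
  have hhy : h * (T.o (T.o y) * T.o y) = h := by grind
  have key : T.o (x * y) = T.o y * h * T.o x := by
    have e3 : x * h * y = x * y := by grind
    refine T.o_eq (hmem (T.o_mem_transversal _) (T.o_mem_transversal _)) ?_ ?_
    · calc x * y * (T.o y * h * T.o x) * (x * y)
          = x * ((T.o x * x * (y * T.o y)) * h * (T.o x * x * (y * T.o y))) * y := by grind
        _ = x * y := by rw [hh, hi, hi, e3]
    · calc T.o y * h * T.o x * (x * y) * (T.o y * h * T.o x)
          = T.o y * (h * (T.o x * x * (y * T.o y)) * h) * T.o x := by simp only [mul_assoc]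
        _ = _ := by rw [hh, hi, hi]
  refine ⟨key, ?_⟩
  rw [key]
  refine T.o_eq (hmem (T.o_mem_transversal _) (T.o_mem_transversal _)) ?_ ?_
  · calc T.o y * h * T.o x * (T.o (T.o x) * h * T.o (T.o y)) * (T.o y * h * T.o x)
        = T.o y * (h * (T.o x * T.o (T.o x) * h) * (T.o (T.o y) * T.o y) * h) * T.o x := by
          simp only [mul_assoc]
      _ = _ := by rw [hxh, hi, hhy, hi]
  · calc T.o (T.o x) * h * T.o (T.o y) * (T.o y * h * T.o x) * (T.o (T.o x) * h * T.o (T.o y))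
        = T.o (T.o x) * (h * (T.o (T.o y) * T.o y) * h * (T.o x * T.o (T.o x) * h)) *
            T.o (T.o y) := by
          simp only [mul_assoc]
      _ = _ := by rw [hxh, hhy, hi, hi]

theorem IsMultiplicative.mul_o_mul_o_o (hT : T.IsMultiplicative) (x y : S) :
    x * y * T.o (x * y) * T.o (T.o (x * y)) = x * y * T.o y * T.o (T.o y) := by
  obtain ⟨hi1, hi2⟩ := hT.o_mul x y
  have hi : _ * _ = _ := (hT x y).2
  rw [hi2, hi1]
  have hx1 := T.mul_o_mul x
  have hx3 := T.mul_o_mul (T.o x)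
  generalize hh : T.o x * x * (y * T.o y) = h at hi
  have hxh : T.o x * T.o (T.o x) * h = h := by grind
  have hxy : x * h = x * y * T.o y := by grind
  calc x * y * (T.o y * h * T.o x) * (T.o (T.o x) * h * T.o (T.o y))
      = (x * y * T.o y) * (h * (T.o x * T.o (T.o x) * h)) * T.o (T.o y) := by
        simp only [mul_assoc]
    _ = x * (h * h) * T.o (T.o y) := by rw [hxh, hi, ← hxy, mul_assoc x h h, hi]
    _ = _ := by rw [hi, hxy]

theorem IsMultiplicative.o_o_mul_o_mul (hT : T.IsMultiplicative) (x y : S) :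
    T.o (T.o (x * y)) * T.o (x * y) * (x * y) = T.o (T.o x) * T.o x * x * y := by
  obtain ⟨hi1, hi2⟩ := hT.o_mul x y
  have hi : _ * _ = _ := (hT x y).2
  rw [hi2, hi1]
  have hy1 := T.mul_o_mul y
  have hy3 := T.mul_o_mul (T.o y)
  generalize hh : T.o x * x * (y * T.o y) = h at hi
  have hhy : h * (T.o (T.o y) * T.o y) = h := by grind
  have hxy : h * y = T.o x * x * y := by grind
  calc T.o (T.o x) * h * T.o (T.o y) * (T.o y * h * T.o x) * (x * y)
      = T.o (T.o x) * (h * (T.o (T.o y) * T.o y) * h) * (T.o x * x * y) := by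
        simp only [mul_assoc]
    _ = T.o (T.o x) * (h * h) * y := by rw [hhy, ← hxy, hi]; grind
    _ = _ := by rw [hi, mul_assoc, hxy]; simp only [mul_assoc]

theorem IsMultiplicative.mul_mem_transversal (hT : T.IsMultiplicative) {a x : S}
    (ha : a ∈ T.RsetI) (hx : x ∈ T.LsetI) : a * x ∈ S0 := by
  have ha1 := T.self_mul_o ha
  have hx1 := T.o_mul_self hx
  have ha2 := T.mul_o_mul a
  have hx2 := T.mul_o_mul x
  have : a * x = T.o (T.o a) * (T.o a * a * (x * T.o x)) * T.o (T.o x) := by grind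
  rw [this]
  exact T.mul_mem_of_mem (T.mul_mem_of_mem (T.o_mem_transversal _) (hT a x).1)
    (T.o_mem_transversal _)

theorem IsMultiplicative.o_idem (hT : T.IsMultiplicative) {e : S} (he : e * e = e) :
    T.o (T.o e) = T.o e := by
  have h : _ * _ = _ := (hT e e).2
  have h1 := T.o_mul_o e
  have h2 : T.o e * e * (e * T.o e) = T.o e := by grind
  rw [h2] at h
  exact T.o_eq (T.o_mem_transversal e) (by rw [h, h]) (by rw [h, h])

theorem IsMultiplicative.mul_idem (hT : T.IsMultiplicative) {e f : S} (he : e ∈ T.RsetI)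
    (hf : f ∈ T.LsetI) (hee : e * e = e) (hff : f * f = f) : e * f * (e * f) = e * f := by
  have he1 := T.self_mul_o he
  have hf1 := T.o_mul_self hf
  rw [hT.o_idem hee] at he1
  rw [hT.o_idem hff] at hf1
  have h : _ * _ = _ := (hT e f).2
  have h1 := T.mul_o_mul e
  have h2 := T.mul_o_mul f
  have h5 := T.mul_o_mul (T.o e)
  have h6 := T.mul_o_mul (T.o f)
  grind

theorem IsMultiplicative.isoOn (hT : T.IsMultiplicative) :
    IsoOn (mulOf S) (invSpMul T) Set.univ (invSpSet T) := by
  refine ⟨fun x => (x * T.o x * T.o (T.o x), T.o (T.o x) * T.o x * x), ⟨?_, ?_, ?_⟩, ?_⟩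
  · intro x _
    exact ⟨T.left_mem_LsetI x, T.right_mem_RsetI x, by simp only [o_mul_o_o, o_o_o_mul]⟩
  · intro x _ y _ hxy
    obtain ⟨h1, h2⟩ := Prod.mk.inj hxy
    have ho : T.o x = T.o y := by rw [← T.o_mul_o_o x, ← T.o_mul_o_o y, h1]
    have key (z : S) : (z * T.o z * T.o (T.o z)) * T.o z * (T.o (T.o z) * T.o z * z) = z := by
      have := T.mul_o_mul z
      have := T.mul_o_mul (T.o z)
      grind
    rw [← key x, h1, h2, ho, key y]
  · rintro ⟨x, a⟩ ⟨hx, ha, hxa⟩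
    dsimp only at hx ha hxa
    have hx1 := T.o_mul_self hx
    have ha1 := T.self_mul_o ha
    have h1 := T.mul_o_mul x
    have h2 := T.mul_o_mul a
    refine ⟨x * T.o x * a, trivial, ?_⟩
    simp only [T.o_mul_o_mul hxa]
    refine Prod.ext ?_ ?_ <;> dsimp only
    · calc x * T.o x * a * T.o x * T.o (T.o x)
          = x * T.o x * (a * T.o a) * T.o (T.o x) := by rw [hxa]; simp only [mul_assoc]
        _ = x := by rw [ha1, ← hxa]; grind
    · rw [hxa] at *
      grind
  · intro x _ y _
    change (x * y * T.o (x * y) * T.o (T.o (x * y)), T.o (T.o (x * y)) * T.o (x * y) * (x * y)) =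
      invSpMul T _ _
    rw [hT.mul_o_mul_o_o, hT.o_o_mul_o_mul]
    have hx1 := T.mul_o_mul x
    have hy1 := T.mul_o_mul y
    have hx2 := T.mul_o_mul (T.o x)
    have hy2 := T.mul_o_mul (T.o y)
    simp only [invSpMul, o_mul_o_o, o_o_o_mul, mulOf]
    refine Prod.ext ?_ ?_ <;> dsimp only <;> grind

end Semigroup

end InverseTransversalOn

/-- Two semigroups `L` and `R` with a common inverse transversal `G`, embedded by `jL` and `jR`,
and a map `R × L → G`.  Here `lam x` and `rho a` are the elements `x⁰` and `a⁰` of `G`. -/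
structure SpinedProduct (L R G : Type*) [Semigroup L] [Semigroup R] [Semigroup G] where
  jL : G → L
  jR : G → R
  inv : G → G
  lam : L → G
  rho : R → G
  st : R → L → G
  jL_injective : Function.Injective jL
  jR_injective : Function.Injective jR
  jL_mul : ∀ s t, jL (s * t) = jL s * jL t
  jR_mul : ∀ s t, jR (s * t) = jR s * jR t
  mul_inv_mul : ∀ s, s * inv s * s = s
  inv_mul_inv : ∀ s, inv s * s * inv s = inv s
  inv_inv : ∀ s, inv (inv s) = s
  mul_comm_of_idem : ∀ s t : G, s * s = s → t * t = t → s * t = t * s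
  lam_jL : ∀ s, lam (jL s) = inv s
  rho_jR : ∀ s, rho (jR s) = inv s
  mul_lam_mul : ∀ x, x * jL (lam x) * x = x
  mul_rho_mul : ∀ a, a * jR (rho a) * a = a
  lam_mul : ∀ x, jL (lam x) * x = jL (lam x * inv (lam x))
  mul_rho : ∀ a, a * jR (rho a) = jR (inv (rho a) * rho a)
  lam_eq : ∀ x t, x * jL t * x = x → jL t * x * jL t = jL t → lam x = t
  rho_eq : ∀ a t, a * jR t * a = a → jR t * a * jR t = jR t → rho a = t
  st_mul_st : ∀ y z a b, lam y = rho b →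
    st (jR (st a y) * (jR (rho b) * b)) z = st a (y * jL (lam y) * jL (st b z))
  jL_st : ∀ s x, jL (st (jR s) x) = jL s * x
  jR_st : ∀ a s, jR (st a (jL s)) = a * jR s
  st_idem : ∀ e f, e * e = e → f * f = f → st e f * st e f = st e f

namespace SpinedProduct

variable {L R G : Type*} [Semigroup L] [Semigroup R] [Semigroup G] (D : SpinedProduct L R G)

/-- The multiplication `(x,a)(y,b) = ((xx⁰)(a∗y), (a∗y)(b⁰b))`. -/
def mul (p q : L × R) : L × R :=
  (p.1 * D.jL (D.lam p.1) * D.jL (D.st p.2 q.1),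
    D.jR (D.st p.2 q.1) * (D.jR (D.rho q.2) * q.2))

theorem st_jR_jL (s t : G) : D.st (D.jR s) (D.jL t) = s * t :=
  D.jR_injective (by rw [jR_st, jR_mul])

theorem st_jR_mul_eq (s : G) (b : R) (z : L) :
    D.st (D.jR s * b) z = s * (D.inv (D.rho b) * D.rho b * D.st b z) := by
  have h := D.st_mul_st (D.jL (D.inv (D.rho b))) z (D.jR s) b (by rw [lam_jL, inv_inv])
  have hb : D.jR (D.inv (D.rho b)) * (D.jR (D.rho b) * b) = b := by
    rw [← mul_assoc, ← jR_mul, ← mul_rho, mul_rho_mul]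
  rw [st_jR_jL, jR_mul, mul_assoc, hb, lam_jL, inv_inv, ← jL_mul, ← jL_mul, st_jR_jL] at h
  exact h

theorem st_mul_jL_eq (a : R) (y : L) (s : G) :
    D.st a (y * D.jL s) = D.st a y * (D.lam y * D.inv (D.lam y)) * s := by
  have h := D.st_mul_st y (D.jL s) a (D.jR (D.inv (D.lam y))) (by rw [rho_jR, inv_inv])
  have hy : y * D.jL (D.lam y) * D.jL (D.inv (D.lam y)) = y := by
    rw [mul_assoc, ← jL_mul, ← lam_mul, ← mul_assoc, mul_lam_mul]
  rw [st_jR_jL, jL_mul, ← mul_assoc (y * _), hy, rho_jR, inv_inv, ← jR_mul, ← jR_mul, st_jR_jL] at h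
  exact h.symm

theorem jR_inv_rho_mul (a : R) : D.jR (D.inv (D.rho a) * D.rho a) * a = a := by
  rw [← mul_rho, mul_rho_mul]

theorem mul_jL_lam_inv (x : L) : x * D.jL (D.lam x * D.inv (D.lam x)) = x := by
  rw [← lam_mul, ← mul_assoc, mul_lam_mul]

theorem inv_rho_mul_st (a : R) (y : L) : D.inv (D.rho a) * D.rho a * D.st a y = D.st a y := by
  have h := D.st_jR_mul_eq (D.inv (D.rho a) * D.rho a) a y
  rw [jR_inv_rho_mul] at h
  have := D.inv_mul_inv (D.rho a)
  grind

theorem st_mul_lam_inv (a : R) (y : L) : D.st a y * (D.lam y * D.inv (D.lam y)) = D.st a y := by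
  have h := D.st_mul_jL_eq a y (D.lam y * D.inv (D.lam y))
  rw [mul_jL_lam_inv] at h
  have := D.mul_inv_mul (D.lam y)
  grind

theorem st_jR_mul (s : G) (b : R) (z : L) : D.st (D.jR s * b) z = s * D.st b z := by
  rw [st_jR_mul_eq, inv_rho_mul_st]

theorem st_mul_jL (a : R) (y : L) (s : G) : D.st a (y * D.jL s) = D.st a y * s := by
  rw [st_mul_jL_eq, st_mul_lam_inv]

theorem lam_left {x : L} {g : G} (h : D.inv (D.lam x) * D.lam x * g = g) :
    D.lam (x * D.jL (D.lam x) * D.jL g) = D.inv g := by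
  have h1 : D.jL (D.lam x) * x * D.jL (D.lam x) = D.jL (D.lam x) := by
    rw [lam_mul, ← jL_mul, mul_inv_mul]
  have h2 := congrArg D.jL h
  have h3 := congrArg D.jL (D.mul_inv_mul g)
  have h4 := congrArg D.jL (D.inv_mul_inv g)
  have h5 : D.jL g * D.jL (D.inv g) * (x * D.jL (D.lam x)) * D.jL g = D.jL g := by
    have h6 : D.inv g * (D.inv (D.lam x) * D.lam x) = D.inv g := by
      have h7 := D.mul_comm_of_idem (g * D.inv g) (D.inv (D.lam x) * D.lam x)
        (by rw [← mul_assoc, mul_inv_mul]) (by rw [← mul_assoc, inv_mul_inv])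
      have := D.inv_mul_inv g
      grind
    have h8 := congrArg D.jL h6
    simp only [jL_mul] at h2 h3 h4 h8
    grind
  simp only [jL_mul] at h2 h3 h4
  apply D.lam_eq
  · grind
  · grind

theorem rho_right {b : R} {g : G} (h : g * (D.rho b * D.inv (D.rho b)) = g) :
    D.rho (D.jR g * (D.jR (D.rho b) * b)) = D.inv g := by
  have h1 : D.jR (D.rho b) * b * D.jR (D.rho b) = D.jR (D.rho b) := by
    rw [mul_assoc, mul_rho, ← jR_mul, ← mul_assoc, mul_inv_mul]
  have h2 := congrArg D.jR h
  have h3 := congrArg D.jR (D.mul_inv_mul g)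
  have h4 := congrArg D.jR (D.inv_mul_inv g)
  have h5 : D.jR g * (D.jR (D.rho b) * b) * D.jR (D.inv g) * D.jR g = D.jR g := by
    have h6 : D.rho b * D.inv (D.rho b) * D.inv g = D.inv g := by
      have h7 := D.mul_comm_of_idem (D.inv g * g) (D.rho b * D.inv (D.rho b))
        (by rw [← mul_assoc, inv_mul_inv]) (by rw [← mul_assoc, mul_inv_mul])
      have := D.inv_mul_inv g
      grind
    have h8 := congrArg D.jR h6
    simp only [jR_mul] at h2 h3 h4 h8
    grind
  simp only [jR_mul] at h2 h3 h4
  apply D.rho_eq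
  · grind
  · grind

variable {D}

theorem lam_mul_fst {p q : L × R} (hp : D.lam p.1 = D.rho p.2) :
    D.lam (D.mul p q).1 = D.inv (D.st p.2 q.1) :=
  D.lam_left (by rw [hp, inv_rho_mul_st])

theorem rho_mul_snd {p q : L × R} (hq : D.lam q.1 = D.rho q.2) :
    D.rho (D.mul p q).2 = D.inv (D.st p.2 q.1) :=
  D.rho_right (by rw [← hq, st_mul_lam_inv])

theorem mul_assoc' {p q r : L × R} (hp : D.lam p.1 = D.rho p.2) (hq : D.lam q.1 = D.rho q.2)
    (hr : D.lam r.1 = D.rho r.2) : D.mul (D.mul p q) r = D.mul p (D.mul q r) := by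
  have hk : D.st (D.mul p q).2 r.1 = D.st p.2 (D.mul q r).1 := D.st_mul_st _ _ _ _ hq
  have h1 : D.st p.2 q.1 * D.inv (D.st p.2 q.1) * D.st (D.mul p q).2 r.1 =
      D.st (D.mul p q).2 r.1 := by
    rw [← st_jR_mul]
    congr 1
    simp only [mul]
    rw [← mul_assoc, ← jR_mul, mul_inv_mul]
  have h2 : D.st p.2 (D.mul q r).1 * (D.inv (D.st q.2 r.1) * D.st q.2 r.1) =
      D.st p.2 (D.mul q r).1 := by
    rw [← st_mul_jL]
    congr 1
    simp only [mul]
    rw [mul_assoc, ← jL_mul, ← mul_assoc (D.st q.2 r.1), mul_inv_mul]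
  refine Prod.ext ?_ ?_
  · change (D.mul p q).1 * D.jL (D.lam (D.mul p q).1) * D.jL (D.st (D.mul p q).2 r.1) =
      p.1 * D.jL (D.lam p.1) * D.jL (D.st p.2 (D.mul q r).1)
    rw [lam_mul_fst hp, ← hk]
    conv_rhs => rw [← h1]
    simp only [mul, jL_mul, mul_assoc]
  · change D.jR (D.st (D.mul p q).2 r.1) * (D.jR (D.rho r.2) * r.2) =
      D.jR (D.st p.2 (D.mul q r).1) * (D.jR (D.rho (D.mul q r).2) * (D.mul q r).2)
    rw [rho_mul_snd hr, hk]
    conv_lhs => rw [← h2]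
    simp only [mul, jR_mul, mul_assoc]

theorem mul_diag (s t : G) : D.mul (D.jL s, D.jR s) (D.jL t, D.jR t) =
    (D.jL (s * t), D.jR (s * t)) := by
  simp only [mul, st_jR_jL, lam_jL, rho_jR, ← jL_mul, ← jR_mul]
  rw [← mul_assoc, mul_inv_mul, mul_assoc s t, ← mul_assoc t, mul_inv_mul]

/-- Left multiplication by the inverse of `p` in the diagonal. -/
theorem diag_mul {p : L × R} (hp : D.lam p.1 = D.rho p.2) :
    D.mul (D.jL (D.lam p.1), D.jR (D.lam p.1)) p =
      (D.jL (D.lam p.1 * D.inv (D.lam p.1)), D.jR (D.rho p.2) * p.2) := by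
  have h : D.st (D.jR (D.lam p.1)) p.1 = D.lam p.1 * D.inv (D.lam p.1) :=
    D.jL_injective (by rw [jL_st, lam_mul])
  simp only [mul, h, lam_jL, ← jL_mul]
  have h1 := D.mul_inv_mul (D.lam p.1)
  refine Prod.ext ?_ ?_ <;> dsimp only
  · rw [← mul_assoc, h1]
  · rw [← mul_assoc, ← jR_mul, hp, mul_inv_mul]

theorem mul_diag_self {p : L × R} (hp : D.lam p.1 = D.rho p.2) :
    D.mul p (D.jL (D.lam p.1), D.jR (D.lam p.1)) =
      (p.1 * D.jL (D.lam p.1), D.jR (D.inv (D.lam p.1) * D.lam p.1)) := by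
  have h : D.st p.2 (D.jL (D.lam p.1)) = D.inv (D.lam p.1) * D.lam p.1 :=
    D.jR_injective (by rw [jR_st, hp, mul_rho])
  simp only [mul, h, rho_jR, ← jR_mul]
  have h1 := D.mul_inv_mul (D.lam p.1)
  refine Prod.ext ?_ ?_ <;> dsimp only
  · rw [mul_assoc, ← jL_mul, ← mul_assoc, h1]
  · congr 1
    grind

theorem mul_diag_mul {p : L × R} (hp : D.lam p.1 = D.rho p.2) :
    D.mul (D.mul p (D.jL (D.lam p.1), D.jR (D.lam p.1))) p = p := by
  rw [mul_assoc' hp (by rw [lam_jL, rho_jR]) hp, diag_mul hp]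
  have h : D.st p.2 (D.jL (D.lam p.1 * D.inv (D.lam p.1))) = D.inv (D.lam p.1) := by
    apply D.jR_injective
    rw [jR_st, jR_mul, ← mul_assoc, hp, mul_rho, ← jR_mul, inv_mul_inv]
  have h1 : D.rho (D.jR (D.rho p.2) * p.2) = D.rho p.2 * D.inv (D.rho p.2) := by
    have h2 : D.jR (D.rho p.2) * p.2 * D.jR (D.rho p.2) = D.jR (D.rho p.2) := by
      rw [mul_assoc, mul_rho, ← jR_mul, ← mul_assoc, mul_inv_mul]
    have h3 := congrArg D.jR (D.mul_inv_mul (D.rho p.2))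
    have h4 := D.jR_inv_rho_mul p.2
    have h5 := congrArg D.jR (D.inv_mul_inv (D.rho p.2))
    simp only [jR_mul] at h3 h4 h5
    apply D.rho_eq <;> rw [jR_mul] <;> grind
  simp only [mul, h, h1]
  refine Prod.ext ?_ ?_ <;> dsimp only
  · rw [mul_assoc, ← jL_mul, mul_jL_lam_inv]
  · rw [← mul_assoc, ← mul_assoc, ← jR_mul, ← jR_mul, hp, ← mul_assoc, inv_mul_inv,
      jR_inv_rho_mul]

theorem diag_mul_diag {p : L × R} (hp : D.lam p.1 = D.rho p.2) :
    D.mul (D.mul (D.jL (D.lam p.1), D.jR (D.lam p.1)) p) (D.jL (D.lam p.1), D.jR (D.lam p.1)) =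
      (D.jL (D.lam p.1), D.jR (D.lam p.1)) := by
  have hd : D.lam (D.jL (D.lam p.1), D.jR (D.lam p.1)).1 =
    D.rho (D.jL (D.lam p.1), D.jR (D.lam p.1)).2 := by rw [lam_jL, rho_jR]
  rw [mul_assoc' hd hp hd, mul_diag_self hp]
  have h : D.st (D.jR (D.lam p.1)) (p.1 * D.jL (D.lam p.1)) = D.lam p.1 := by
    apply D.jL_injective
    rw [jL_st, ← mul_assoc, lam_mul, ← jL_mul, mul_inv_mul]
  simp only [mul, h, lam_jL, rho_jR, ← jL_mul, ← jR_mul]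
  have h1 := D.mul_inv_mul (D.lam p.1)
  have h2 : D.inv (D.inv (D.lam p.1) * D.lam p.1) = D.inv (D.lam p.1) * D.lam p.1 := by
    rw [← D.lam_jL]
    apply D.lam_eq <;> simp only [← jL_mul] <;> congr 1 <;> grind
  refine Prod.ext ?_ ?_ <;> dsimp only
  · rw [h1]
  · rw [h2]
    congr 1
    grind

/-- A diagonal inverse `(t,t)` of `(x,a)` satisfies `t = x⁰`. -/
theorem eq_lam {p : L × R} (hp : D.lam p.1 = D.rho p.2) {t : G}
    (h₁ : D.mul (D.mul p (D.jL t, D.jR t)) p = p)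
    (h₂ : D.mul (D.mul (D.jL t, D.jR t) p) (D.jL t, D.jR t) = (D.jL t, D.jR t)) :
    t = D.lam p.1 := by
  have hd : D.lam (D.jL t, D.jR t).1 = D.rho (D.jL t, D.jR t).2 := by rw [lam_jL, rho_jR]
  obtain ⟨x, a⟩ := p
  dsimp only at hp
  set s := D.lam x with hs
  set k := D.st a (D.jL t) with hk
  set l := D.st (D.jR t) x with hl
  have hek : D.inv s * s * k = k := by rw [hp, inv_rho_mul_st]
  have hlf : l * (s * D.inv s) = l := D.st_mul_lam_inv _ _
  have hkx : x * D.jL s * D.jL k * x = x := by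
    have h := congrArg Prod.fst h₁
    change (D.mul (x, a) (D.jL t, D.jR t)).1 * D.jL (D.lam (D.mul (x, a) (D.jL t, D.jR t)).1) *
      D.jL (D.st (D.mul (x, a) (D.jL t, D.jR t)).2 x) = x at h
    rw [lam_mul_fst hp] at h
    simp only [mul, rho_jR, ← jR_mul, ← hk, ← hs] at h
    have hkt : k * (D.inv t * t) = k := by
      rw [hk, ← st_mul_jL, ← jL_mul, ← mul_assoc, mul_inv_mul]
    rw [hkt, jL_st] at h
    have := congrArg D.jL (D.mul_inv_mul k)
    simp only [jL_mul] at this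
    grind
  have hla : a * D.jR l * D.jR s * a = a := by
    have h := congrArg Prod.snd h₁
    rw [mul_assoc' hp hd hp] at h
    change D.jR (D.st a (D.mul (D.jL t, D.jR t) (x, a)).1) *
      (D.jR (D.rho (D.mul (D.jL t, D.jR t) (x, a)).2) * (D.mul (D.jL t, D.jR t) (x, a)).2) = a at h
    rw [rho_mul_snd hp] at h
    simp only [mul, lam_jL, ← jL_mul, ← hl, ← hp] at h
    have htl : t * D.inv t * l = l := by
      rw [hl, ← st_jR_mul, ← jR_mul, mul_inv_mul]
    rw [htl, jR_st] at h
    have := congrArg D.jR (D.mul_inv_mul l)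
    simp only [jR_mul] at this
    grind
  have hss := D.mul_inv_mul s
  have hss' := D.inv_mul_inv s
  have hk' : D.jL k * x = D.jL (D.inv s) := by
    have h1 : D.jL (D.inv s * s) * (D.jL k * x) = D.jL (D.inv s) := by
      have h3 : D.jL s * x = D.jL (s * D.inv s) := D.lam_mul x
      have h5 := congrArg D.jL hss'
      simp only [jL_mul] at *
      grind
    rw [← h1, ← mul_assoc, ← jL_mul, hek]
  have hl' : a * D.jR l = D.jR (D.inv s) := by
    have h1 : a * D.jR l * D.jR (s * D.inv s) = D.jR (D.inv s) := by
      have h3 : a * D.jR s = D.jR (D.inv s * s) := by rw [hp]; exact D.mul_rho a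
      have h5 := congrArg D.jR hss'
      simp only [jR_mul] at *
      grind
    rw [← h1, mul_assoc, ← jR_mul, hlf]
  have hsk : s = s * k := by
    apply D.lam_eq <;> rw [jL_mul]
    · rw [← mul_assoc, hkx]
    · have h4 := congrArg D.jL hss
      simp only [jL_mul] at h4
      grind
  have hls : s = l * s := by
    rw [hp]
    apply D.rho_eq <;> rw [jR_mul, ← hp]
    · rw [← mul_assoc, hla]
    · have h4 := congrArg D.jR hss
      simp only [jR_mul] at h4
      grind
  have ht : t = l * s * k := by
    apply D.jL_injective
    have h := congrArg Prod.fst h₂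
    rw [mul_assoc' hd hp hd] at h
    change D.jL t * D.jL (D.lam (D.jL t)) * D.jL (D.st (D.jR t) (D.mul (x, a) (D.jL t, D.jR t)).1) =
      D.jL t at h
    simp only [mul, ← hk, ← hs] at h
    rw [lam_jL, st_mul_jL, st_mul_jL, ← jL_mul, ← jL_mul, ← hl] at h
    have htl : t * D.inv t * l = l := by
      rw [hl, ← st_jR_mul, ← jR_mul, mul_inv_mul]
    rw [← h, ← mul_assoc, ← mul_assoc, htl]
  rw [ht, ← hls, ← hsk]

theorem multiplicative {p q : L × R} (hp : D.lam p.1 = D.rho p.2) (hq : D.lam q.1 = D.rho q.2) :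
    ∃ g, g * g = g ∧ D.mul (D.mul (D.jL (D.lam p.1), D.jR (D.lam p.1)) p)
      (D.mul q (D.jL (D.lam q.1), D.jR (D.lam q.1))) = (D.jL g, D.jR g) := by
  have h1 : D.jR (D.rho p.2) * p.2 * (D.jR (D.rho p.2) * p.2) = D.jR (D.rho p.2) * p.2 := by
    have := D.mul_rho_mul p.2
    grind
  have h2 : q.1 * D.jL (D.lam q.1) * (q.1 * D.jL (D.lam q.1)) = q.1 * D.jL (D.lam q.1) := by
    have := D.mul_lam_mul q.1
    grind
  refine ⟨_, D.st_idem _ _ h1 h2, ?_⟩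
  rw [diag_mul hp, mul_diag_self hq]
  have hinv {e : G} (he : e * e = e) : D.inv e = e := by
    rw [← D.lam_jL]
    apply D.lam_eq <;> rw [← jL_mul, ← jL_mul, he, he]
  have e1 : D.lam p.1 * D.inv (D.lam p.1) * (D.lam p.1 * D.inv (D.lam p.1)) =
      D.lam p.1 * D.inv (D.lam p.1) := by rw [← mul_assoc, mul_inv_mul]
  have e2 : D.inv (D.lam q.1) * D.lam q.1 * (D.inv (D.lam q.1) * D.lam q.1) =
      D.inv (D.lam q.1) * D.lam q.1 := by rw [← mul_assoc, inv_mul_inv]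
  simp only [mul, lam_jL, rho_jR, hinv e1, hinv e2, ← jL_mul, ← jR_mul, e1, e2]
  refine Prod.ext ?_ ?_ <;> dsimp only
  · congr 1
    rw [← st_jR_mul, ← mul_assoc, ← jR_mul, hp, mul_inv_mul]
  · congr 1
    rw [← st_mul_jL, mul_assoc, ← jL_mul, ← mul_assoc, mul_inv_mul]

theorem lam_eq_rho_of_mem_diag {p : L × R} (h : p ∈ absT0 D.jL D.jR) : D.lam p.1 = D.rho p.2 := by
  obtain ⟨s, rfl⟩ := h
  rw [lam_jL, rho_jR]

variable (D)

/-- The elements `(x,a)` with `x⁰ = a⁰`. -/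
def carrier : Set (L × R) := {p | D.lam p.1 = D.rho p.2}

/-- The diagonal is an inverse transversal of the spined product. -/
def inverseTransversal : InverseTransversalOn D.mul D.carrier (absT0 D.jL D.jR) where
  sub _ := lam_eq_rho_of_mem_diag
  mul_mem := by
    rintro _ ⟨s, rfl⟩ _ ⟨t, rfl⟩
    exact ⟨s * t, mul_diag s t⟩
  o p := (D.jL (D.lam p.1), D.jR (D.lam p.1))
  o_mem p _ := ⟨D.lam p.1, rfl⟩
  o_inv1 _ hp := mul_diag_mul hp
  o_inv2 _ hp := diag_mul_diag hp
  o_unique := by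
    rintro p hp _ ⟨t, rfl⟩ h₁ h₂
    rw [eq_lam hp h₁ h₂]
  idem_comm := by
    rintro _ ⟨s, rfl⟩ _ ⟨t, rfl⟩ hs ht
    simp only [Idem, mul_diag] at hs ht ⊢
    rw [D.mul_comm_of_idem s t (D.jL_injective (congrArg Prod.fst hs))
      (D.jL_injective (congrArg Prod.fst ht))]

theorem semigroupOn : SemigroupOn D.mul D.carrier :=
  ⟨fun _ hp _ hq => (lam_mul_fst hp).trans (rho_mul_snd hq).symm,
    fun _ hp _ hq _ hr => mul_assoc' hp hq hr⟩

theorem isoOn_diag : IsoOn (mulOf G) D.mul Set.univ (absT0 D.jL D.jR) :=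
  ⟨fun s => (D.jL s, D.jR s),
    ⟨fun s _ => ⟨s, rfl⟩, fun _ _ _ _ h => D.jL_injective (congrArg Prod.fst h),
      fun _ ⟨s, hs⟩ => ⟨s, trivial, hs.symm⟩⟩,
    fun s _ t _ => (mul_diag s t).symm⟩

end SpinedProduct

end Paper

open Paper in
/-- As in Statement 17, with the additional condition (3)
`e∗f ∈ E⁰` for all `e ∈ E(R)`, `f ∈ E(L)`: then `T` is a regular semigroup and
`T⁰ = {(s,s)}` is a *multiplicative* inverse transversal of `T` isomorphic to
`S⁰` (multiplicative: `p⁰p qq⁰ ∈ E(T⁰)` for all `p, q ∈ T`).  Conversely every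
regular semigroup with a multiplicative inverse transversal arises this way. -/
theorem stmt19 {L R G : Type u} [Semigroup L] [Semigroup R] [Semigroup G]
    (jL : G → L) (jR : G → R)
    (hjL : Function.Injective jL) (hjR : Function.Injective jR)
    (hjLm : ∀ s t : G, jL (s * t) = jL s * jL t)
    (hjRm : ∀ s t : G, jR (s * t) = jR s * jR t)
    (hG : InverseSgpOn (mulOf G) Set.univ)
    (hL : LeftInverseSgpOn (mulOf L) Set.univ)
    (hR : RightInverseSgpOn (mulOf R) Set.univ)
    (TL : InverseTransversalOn (mulOf L) Set.univ (Set.range jL))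
    (TR : InverseTransversalOn (mulOf R) Set.univ (Set.range jR))
    (hQL : QuasiIdealOn (mulOf L) Set.univ (Set.range jL))
    (hQR : QuasiIdealOn (mulOf R) Set.univ (Set.range jR))
    (st : R → L → G)
    (cond1 : ∀ (y z : L) (a b : R),
      (∃ s : G, jL s = TL.o y ∧ jR s = TR.o b) →
      st (jR (st a y) * (TR.o b * b)) z = st a ((y * TL.o y) * jL (st b z)))
    (cond2L : ∀ (s : G) (x : L), jL (st (jR s) x) = jL s * x)
    (cond2R : ∀ (a : R) (s : G), jR (st a (jL s)) = a * jR s)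
    (cond3 : ∀ (e : R) (f : L), Idem (mulOf R) e → Idem (mulOf L) f →
      Idem (mulOf G) (st e f)) :
    (SemigroupOn (invAbsMul TL TR st) (invAbsTset TL TR) ∧
     RegularOn (invAbsMul TL TR st) (invAbsTset TL TR) ∧
     (∃ T' : InverseTransversalOn (invAbsMul TL TR st) (invAbsTset TL TR) (absT0 jL jR),
        ∀ p ∈ invAbsTset TL TR, ∀ q ∈ invAbsTset TL TR,
          invAbsMul TL TR st (invAbsMul TL TR st (T'.o p) p)
              (invAbsMul TL TR st q (T'.o q)) ∈ absT0 jL jR ∧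
          Idem (invAbsMul TL TR st)
            (invAbsMul TL TR st (invAbsMul TL TR st (T'.o p) p)
              (invAbsMul TL TR st q (T'.o q)))) ∧
     IsoOn (mulOf G) (invAbsMul TL TR st) Set.univ (absT0 jL jR)) ∧
    (∀ (S : Type u) [Semigroup S] (S0 : Set S)
       (T : InverseTransversalOn (mulOf S) Set.univ S0),
       RegularOn (mulOf S) Set.univ →
       (∀ x y : S, (T.o x * x) * (y * T.o y) ∈ S0 ∧
          Idem (mulOf S) ((T.o x * x) * (y * T.o y))) →
       ((∀ y ∈ T.LsetI, ∀ z ∈ T.LsetI, ∀ a ∈ T.RsetI, ∀ b ∈ T.RsetI,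
           T.o y = T.o b →
           (a * y) * (T.o b * b) * z = a * ((y * T.o y) * (b * z))) ∧
        (∀ a ∈ T.RsetI, ∀ x ∈ T.LsetI, a * x ∈ S0) ∧
        (∀ e ∈ T.RsetI, ∀ f ∈ T.LsetI, Idem (mulOf S) e → Idem (mulOf S) f →
           e * f ∈ S0 ∧ Idem (mulOf S) (e * f)) ∧
        IsoOn (mulOf S) (invSpMul T) Set.univ (invSpSet T))) := by
  refine ⟨?_, ?_⟩
  · choose lam hlam using fun x => TL.o_mem_transversal x
    choose rho hrho using fun a => TR.o_mem_transversal a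
    have lam_eq (x : L) (t : G) (h₁ : x * jL t * x = x) (h₂ : jL t * x * jL t = jL t) :
        lam x = t := hjL ((hlam x).trans (TL.o_eq ⟨t, rfl⟩ h₁ h₂))
    have rho_eq (a : R) (t : G) (h₁ : a * jR t * a = a) (h₂ : jR t * a * jR t = jR t) :
        rho a = t := hjR ((hrho a).trans (TR.o_eq ⟨t, rfl⟩ h₁ h₂))
    have mul_inv (s : G) : s * lam (jL s) * s = s := hjL (by
      rw [hjLm, hjLm, hlam]; exact TL.mul_o_mul _)
    have inv_mul (s : G) : lam (jL s) * s * lam (jL s) = lam (jL s) := hjL (by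
      rw [hjLm, hjLm, hlam]; exact TL.o_mul_o _)
    have rho_jR (s : G) : rho (jR s) = lam (jL s) :=
      rho_eq _ _ (by rw [← hjRm, ← hjRm, mul_inv]) (by rw [← hjRm, ← hjRm, inv_mul])
    let D : SpinedProduct L R G :=
      { jL := jL
        jR := jR
        inv := fun s => lam (jL s)
        lam := lam
        rho := rho
        st := st
        jL_injective := hjL
        jR_injective := hjR
        jL_mul := hjLm
        jR_mul := hjRm
        mul_inv_mul := mul_inv
        inv_mul_inv := inv_mul
        inv_inv := fun s => lam_eq _ _ (by rw [← hjLm, ← hjLm, inv_mul])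
          (by rw [← hjLm, ← hjLm, mul_inv])
        mul_comm_of_idem := fun s t => hG.2 s trivial t trivial
        lam_jL := fun _ => rfl
        rho_jR := rho_jR
        mul_lam_mul := fun x => by rw [hlam]; exact TL.mul_o_mul x
        mul_rho_mul := fun a => by rw [hrho]; exact TR.mul_o_mul a
        lam_mul := fun x => by
          rw [hjLm, hlam, hlam]
          exact TL.o_mul_of_leftInverse hL x
        mul_rho := fun a => by
          rw [hjRm, ← rho_jR, hrho, hrho]
          exact TR.mul_o_of_rightInverse hR a
        lam_eq := lam_eq
        rho_eq := rho_eq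
        st_mul_st := fun y z a b h => by
          rw [hlam, hrho]
          exact cond1 y z a b ⟨lam y, hlam y, h ▸ hrho b⟩
        jL_st := cond2L
        jR_st := cond2R
        st_idem := cond3 }
    have hmul : invAbsMul TL TR st = D.mul := by
      funext p q
      simp only [invAbsMul, SpinedProduct.mul, mulOf, D, hlam, hrho]
    have hset : invAbsTset TL TR = D.carrier := by
      ext p
      constructor
      · rintro ⟨s, h₁, h₂⟩
        exact (hjL ((hlam _).trans h₁.symm)).trans (hjR ((hrho _).trans h₂.symm)).symm
      · intro h
        exact ⟨lam p.1, hlam _, (congrArg jR h).trans (hrho _)⟩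
    rw [hmul, hset]
    refine ⟨D.semigroupOn, fun p hp => ?_, ⟨D.inverseTransversal, fun p hp q hq => ?_⟩,
      D.isoOn_diag⟩
    · exact ⟨_, D.inverseTransversal.sub (D.inverseTransversal.o_mem p hp),
        D.inverseTransversal.o_inv1 p hp, D.inverseTransversal.o_inv2 p hp⟩
    · obtain ⟨g, hg, h⟩ := SpinedProduct.multiplicative hp hq
      change D.mul (D.mul (D.jL _, D.jR _) p) (D.mul q (D.jL _, D.jR _)) ∈ _ ∧
        Idem D.mul (D.mul (D.mul (D.jL _, D.jR _) p) (D.mul q (D.jL _, D.jR _)))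
      rw [h]
      exact ⟨⟨g, rfl⟩, by rw [Idem, SpinedProduct.mul_diag, hg]⟩
  · intro S _ S0 T _ hT
    have hT : T.IsMultiplicative := hT
    refine ⟨fun y _ z _ a _ b _ h => ?_, fun a ha x hx => hT.mul_mem_transversal ha hx,
      fun e he f hf hee hff => ⟨hT.mul_mem_transversal he hf, hT.mul_idem he hf hee hff⟩, hT.isoOn⟩
    rw [h]
    simp only [mul_assoc]
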